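/- arXiv:2009.01583 — 2 statements merged into one kernel-verified Lean document; each statement's English description precedes it below -/
import Mathlib

section
/- Let n ≥ 0 and let (u_j(t))_{j≥1} be a solution of the Sabra shell model whose forcing satisfies Φ_n < ∞. Then H_n satisfies the ladder inequality (1/2) dH_n/dt ≤ −ν H_{n+1} + c_n H_n sup_j (k_j |u_j|) + H_n^{1/2} Φ_n^{1/2}, where c_n = λ^{−n+1}(|a|λ^{−2n} + |b| + |a+b|λ^{2n}). -/
open Filter MeasureTheory
open scoped BigOperators Topology

noncomputable section

/-- Logarithmically spaced wavenumbers `k_j = k₀ λ^j`. -/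
def wk (k₀ lam : ℝ) (j : ℕ) : ℝ := k₀ * lam ^ j

/-- Sabra forcing `f_j = F φ_{j - j_f}` (with the convention `φ_p = 0` for `p < 0`). -/
def sabraForcing (F : ℂ) (φ : ℕ → ℂ) (jf j : ℕ) : ℂ :=
  if jf ≤ j then F * φ (j - jf) else 0

/-- Right-hand side of the Sabra shell model
`i(a k_{j+1} u*_{j+1} u_{j+2} + b k_j u_{j+1} u*_{j-1} - c k_{j-1} u_{j-1} u_{j-2}) - ν k_j² u_j + f_j`. -/
def sabraRHS (a b c ν k₀ lam : ℝ) (f : ℕ → ℂ) (v : ℕ → ℂ) (j : ℕ) : ℂ :=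
  Complex.I * (((a * wk k₀ lam (j+1) : ℝ) : ℂ) * (starRingEnd ℂ) (v (j+1)) * v (j+2)
      + ((b * wk k₀ lam j : ℝ) : ℂ) * v (j+1) * (starRingEnd ℂ) (v (j-1))
      - ((c * wk k₀ lam (j-1) : ℝ) : ℂ) * v (j-1) * v (j-2))
    - ((ν * (wk k₀ lam j)^2 : ℝ) : ℂ) * v j + f j

/-- `u` is a solution of the Sabra shell model on the time set `s`
(the boundary conditions `u_0 = u_{-1} = 0` are encoded by `u 0 t = 0` together with
truncated subtraction on the indices). -/
def IsSabraSolution (a b c ν k₀ lam : ℝ) (f : ℕ → ℂ) (u : ℕ → ℝ → ℂ) (s : Set ℝ) : Prop :=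
  (∀ t : ℝ, u 0 t = 0) ∧
  ∀ j : ℕ, 1 ≤ j → ∀ t ∈ s,
    HasDerivAt (fun τ => u j τ) (sabraRHS a b c ν k₀ lam f (fun i => u i t) j) t

/-- Energy `E(t) = Σ_{j≥1} |u_j(t)|²`. -/
def sEnergy (u : ℕ → ℝ → ℂ) (t : ℝ) : ℝ := ∑' j : ℕ, ‖u (j+1) t‖^2

/-- `H_n = Σ_{j≥1} k_j^{2n} |v_j|²`. -/
def HnS (k₀ lam : ℝ) (n : ℕ) (v : ℕ → ℂ) : ℝ :=
  ∑' j : ℕ, (wk k₀ lam (j+1))^(2*n) * ‖v (j+1)‖^2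

/-- `H_{n,m} = Σ_{j≥1} k_j^{2nm} |v_j|^{2m}`. -/
def HnmS (k₀ lam : ℝ) (n m : ℕ) (v : ℕ → ℂ) : ℝ :=
  ∑' j : ℕ, (wk k₀ lam (j+1))^(2*n*m) * ‖v (j+1)‖^(2*m)

/-- `Φ_n = Σ_{j≥1} k_j^{2n} |f_j|²`. -/
def PhinS (k₀ lam : ℝ) (n : ℕ) (f : ℕ → ℂ) : ℝ :=
  ∑' j : ℕ, (wk k₀ lam (j+1))^(2*n) * ‖f (j+1)‖^2

/-- Time average `⟨g⟩ = T⁻¹ ∫_0^T g dt`. -/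
def timeAvg (T : ℝ) (g : ℝ → ℝ) : ℝ := T⁻¹ * ∫ t in (0:ℝ)..T, g t

/-- `C_γ = Σ_{p≥0} λ^{2γp} |φ_p|²`. -/
def CgS (lam γ : ℝ) (φ : ℕ → ℂ) : ℝ := ∑' p : ℕ, lam ^ (2*γ*(p:ℝ)) * ‖φ p‖^2

/-- `B_γ = sup_{p≥0} λ^{-(2γ-1)p} |φ_p|`. -/
def BgS (lam γ : ℝ) (φ : ℕ → ℂ) : ℝ := ⨆ p : ℕ, lam ^ (-(2*γ-1)*(p:ℝ)) * ‖φ p‖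

/-- `A = |a|λ + |b| + |a+b|λ⁻¹`. -/
def AconstS (a b lam : ℝ) : ℝ := |a| * lam + |b| + |a + b| * lam⁻¹

/-- `c_n = λ^{-n+1}(|a|λ^{-2n} + |b| + |a+b|λ^{2n})`. -/
def cnS (a b lam : ℝ) (n : ℕ) : ℝ :=
  lam ^ (1 - (n:ℤ)) * (|a| * lam ^ (-(2*(n:ℤ))) + |b| + |a + b| * lam ^ (2*(n:ℤ)))

/-- `d_n = c_n²/(2λ⁴)`. -/
def dnS (a b lam : ℝ) (n : ℕ) : ℝ := (cnS a b lam n)^2 / (2 * lam^4)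

/-- `U = ⟨E⟩^{1/2}` over `[0,T]`. -/
def Uavg (u : ℕ → ℝ → ℂ) (T : ℝ) : ℝ := Real.sqrt (timeAvg T (sEnergy u))

/-- Reynolds number `Re = U/(ν k_f)` over `[0,T]`. -/
def ReynoldsNum (u : ℕ → ℝ → ℂ) (T ν kf : ℝ) : ℝ := Uavg u T / (ν * kf)

/-- Time-averaged energy-dissipation rate `ε = ν ⟨Σ_j k_j² |u_j|²⟩` over `[0,T]`. -/
def epsAvg (k₀ lam ν : ℝ) (u : ℕ → ℝ → ℂ) (T : ℝ) : ℝ :=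
  ν * timeAvg T (fun t => HnS k₀ lam 1 (fun j => u j t))


/-- comparison lemma -/
theorem core_deriv (g g' : ℕ → ℝ → ℝ) (t D : ℝ) (Ψ : ℝ → ℝ)
    (hg : ∀ j s, HasDerivAt (g j) (g' j s) s)
    (hsum : ∀ᶠ s in 𝓝 t, Summable (fun j => g j s))
    (hD : HasDerivAt (fun s => ∑' j, g j s) D t)
    (hΨ : ContinuousAt Ψ t)
    (hb : ∃ N0 : ℕ, ∀ᶠ s in 𝓝 t, ∀ N ≥ N0, ∑ j ∈ Finset.range N, g' j s ≤ Ψ s) :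
    D ≤ Ψ t := by
  obtain ⟨N0, hb⟩ := hb
  refine le_of_forall_pos_le_add fun η hη => ?_
  have h1 : ∀ᶠ s in 𝓝 t, Ψ s < Ψ t + η := hΨ.eventually (gt_mem_nhds (by linarith))
  obtain ⟨r, hr, hball⟩ := Metric.eventually_nhds_iff_ball.1 ((h1.and hb).and hsum)
  have key : ∀ τ, t < τ → τ < t + r → (∑' j, g j τ) - (∑' j, g j t) ≤ (Ψ t + η) * (τ - t) := by
    intro τ h1 h2
    have inb : ∀ s, t ≤ s → s ≤ τ → s ∈ Metric.ball t r := by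
      intro s ha hb
      rw [Metric.mem_ball, Real.dist_eq, abs_of_nonneg (by linarith)]; linarith
    have ht1 := (hball τ (inb τ h1.le le_rfl)).2.hasSum.tendsto_sum_nat
    have ht2 := (hball t (inb t le_rfl h1.le)).2.hasSum.tendsto_sum_nat
    refine le_of_tendsto (ht1.sub ht2) ?_
    filter_upwards [eventually_ge_atTop N0] with N hN
    have hS : ∀ s, HasDerivAt (fun s => ∑ j ∈ Finset.range N, g j s)
        (∑ j ∈ Finset.range N, g' j s) s := fun s => HasDerivAt.fun_sum fun j _ => hg j s
    refine Convex.image_sub_le_mul_sub_of_deriv_le (convex_Icc t τ)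
      (f := fun s => ∑ j ∈ Finset.range N, g j s)
      (fun s _ => (hS s).continuousAt.continuousWithinAt)
      (fun s _ => (hS s).differentiableAt.differentiableWithinAt) ?_ t ⟨le_rfl, h1.le⟩ τ
      ⟨h1.le, le_rfl⟩ h1.le
    intro s hs
    rw [(hS s).deriv]
    have hs' := interior_subset hs
    have := hball s (inb s hs'.1 hs'.2)
    exact (this.1.2 N hN).trans this.1.1.le
  have hsl := (hasDerivAt_iff_tendsto_slope.1 hD).mono_left
    (nhdsWithin_mono t (s := Set.Ioi t) (fun x (hx : t < x) => ne_of_gt hx))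
  refine le_of_tendsto hsl ?_
  filter_upwards [Ioo_mem_nhdsGT (show t < t + r by linarith)] with τ hτ
  rw [slope_def_field, div_le_iff₀ (by linarith [hτ.1])]
  exact key τ hτ.1 hτ.2

/-- uniform smallness of tails -/
theorem core_tail (g : ℕ → ℝ → ℝ) (t : ℝ)
    (hg0 : ∀ j s, 0 ≤ g j s)
    (hg : ∀ j, ContinuousAt (g j) t)
    (hsum : ∀ᶠ s in 𝓝 t, Summable (fun j => g j s))
    (hD : ContinuousAt (fun s => ∑' j, g j s) t) (ε : ℝ) (hε : 0 < ε) :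
    ∃ N0 : ℕ, ∀ᶠ s in 𝓝 t, ∀ j ≥ N0, g j s ≤ ε := by
  have h0 := hsum.self_of_nhds.hasSum.tendsto_sum_nat
  obtain ⟨N0, hN⟩ := (h0.eventually (lt_mem_nhds (show (∑' j, g j t) - ε < ∑' j, g j t by linarith))).exists
  refine ⟨N0, ?_⟩
  have hc : ContinuousAt (fun s => (∑' j, g j s) - ∑ j ∈ Finset.range N0, g j s) t :=
    hD.sub (tendsto_finsetSum _ fun j _ => hg j)
  filter_upwards [hsum, hc.eventually (gt_mem_nhds (show _ < ε by linarith))] with s hs h2 j hj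
  have := hs.sum_le_tsum (insert j (Finset.range N0)) (fun i _ => hg0 i s)
  rw [Finset.sum_insert (by simpa using hj)] at this
  linarith

/-- derivative of the weighted square norm -/
theorem hasDeriv_normsq (w : ℝ) (v : ℝ → ℂ) (v' : ℂ) (s : ℝ) (h : HasDerivAt v v' s) :
    HasDerivAt (fun τ => w * ‖v τ‖^2) (2 * (w * ((starRingEnd ℂ) (v s) * v').re)) s := by
  have := (h.norm_sq).const_mul w
  have e : 2 * (w * ((starRingEnd ℂ) (v s) * v').re) = w * (2 * inner ℝ (v s) v') := by
    rw [Complex.inner]; ring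
  rw [e]; exact this

/-- triple product -/
def triX (v : ℕ → ℂ) (i : ℕ) : ℝ :=
  ((starRingEnd ℂ) (v i) * (starRingEnd ℂ) (v (i+1)) * v (i+2)).im

theorem triX_zero (v : ℕ → ℂ) (h : v 0 = 0) : triX v 0 = 0 := by simp [triX, h]

theorem triX_abs (v : ℕ → ℂ) (i : ℕ) : |triX v i| ≤ ‖v i‖ * ‖v (i+1)‖ * ‖v (i+2)‖ := by
  refine (Complex.abs_im_le_norm _).trans ?_
  simp

theorem rhs_re (a b c ν k₀ lam : ℝ) (f v : ℕ → ℂ) (h0 : v 0 = 0) (i : ℕ) :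
    ((starRingEnd ℂ) (v (i+1)) * sabraRHS a b c ν k₀ lam f v (i+1)).re
     = -(a * (wk k₀ lam (i+2) * triX v (i+1)) + b * (wk k₀ lam (i+1) * triX v i)
        + c * (wk k₀ lam (i-1+1) * triX v (i-1)))
       - ν * ((wk k₀ lam (i+1))^2 * ‖v (i+1)‖^2) + ((starRingEnd ℂ) (v (i+1)) * f (i+1)).re := by
  rw [Complex.sq_norm, Complex.normSq_apply]
  rcases i with _ | i
  · simp [sabraRHS, triX, h0, sq]
    ring
  · simp [sabraRHS, triX, sq]
    ring

theorem forcing_le (w : ℕ → ℝ) (hw : ∀ j, 0 ≤ w j) (v f : ℕ → ℂ)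
    (hv : Summable (fun j => w j * ‖v j‖^2)) (hf : Summable (fun j => w j * ‖f j‖^2)) (N : ℕ) :
    ∑ j ∈ Finset.range N, w j * ((starRingEnd ℂ) (v j) * f j).re ≤
      Real.sqrt (∑' j, w j * ‖v j‖^2) * Real.sqrt (∑' j, w j * ‖f j‖^2) := by
  have h1 : ∑ j ∈ Finset.range N, w j * ((starRingEnd ℂ) (v j) * f j).re ≤
      ∑ j ∈ Finset.range N, (Real.sqrt (w j) * ‖v j‖) * (Real.sqrt (w j) * ‖f j‖) := by
    refine Finset.sum_le_sum fun j _ => ?_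
    have : ((starRingEnd ℂ) (v j) * f j).re ≤ ‖v j‖ * ‖f j‖ := by
      refine (Complex.re_le_norm _).trans ?_
      simp
    calc _ ≤ w j * (‖v j‖ * ‖f j‖) := mul_le_mul_of_nonneg_left this (hw j)
      _ = (Real.sqrt (w j) * Real.sqrt (w j)) * (‖v j‖ * ‖f j‖) := by rw [Real.mul_self_sqrt (hw j)]
      _ = _ := by ring
  refine h1.trans ((Real.sum_mul_le_sqrt_mul_sqrt _ _ _).trans ?_)
  simp only [mul_pow, Real.sq_sqrt (hw _)]
  refine mul_le_mul (Real.sqrt_le_sqrt ?_) (Real.sqrt_le_sqrt ?_) (by positivity) (by positivity)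
  · exact hv.sum_le_tsum _ fun j _ => mul_nonneg (hw j) (by positivity)
  · exact hf.sum_le_tsum _ fun j _ => mul_nonneg (hw j) (by positivity)

/-- energy telescoping -/
theorem tele (a b c : ℝ) (h : a + b + c = 0) (Y : ℕ → ℝ) (hY : Y 0 = 0) (N : ℕ) :
    ∑ i ∈ Finset.range (N+1), -(a * Y (i+1) + b * Y i + c * Y (i-1)) = -(a * Y (N+1) - c * Y N) := by
  induction N with
  | zero => simp [hY]
  | succ N ih =>
    rw [Finset.sum_range_succ, ih]
    have : b = -a - c := by linarith
    subst this
    simp only [Nat.add_sub_cancel]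
    ring

theorem lim0 (D : ℝ) (F : ℝ → ℝ) (hF : Continuous F) (h : ∀ ε, 0 < ε → D ≤ F ε) : D ≤ F 0 := by
  have : Tendsto F (𝓝[>] 0) (𝓝 (F 0)) := hF.continuousAt.tendsto.mono_left nhdsWithin_le_nhds
  refine ge_of_tendsto this ?_
  filter_upwards [self_mem_nhdsWithin] with ε hε using h ε hε

theorem shift_sum_le (g : ℕ → ℝ) (h0 : ∀ i, 0 ≤ g i) (hs : Summable g) (p N : ℕ) :
    ∑ i ∈ Finset.range N, g (i+p) ≤ ∑' i, g i := by
  have h1 := Finset.sum_range_add g p N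
  have h2 := hs.sum_le_tsum (Finset.range (p+N)) (fun i _ => h0 i)
  have h3 : 0 ≤ ∑ i ∈ Finset.range p, g i := Finset.sum_nonneg fun i _ => h0 i
  have h4 : ∑ i ∈ Finset.range N, g (i+p) = ∑ i ∈ Finset.range N, g (p+i) :=
    Finset.sum_congr rfl fun i _ => by rw [add_comm]
  linarith

theorem wk_pos {k₀ lam : ℝ} (hk₀ : 0 < k₀) (hlam : 1 < lam) (j : ℕ) : 0 < wk k₀ lam j := by
  unfold wk; positivity

theorem wk_succ (k₀ lam : ℝ) (j : ℕ) : wk k₀ lam (j+1) = lam * wk k₀ lam j := by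
  unfold wk; ring

theorem nl_bound (a b c k₀ lam : ℝ) (hk₀ : 0 < k₀) (hlam : 1 < lam) (habc : a + b + c = 0)
    (n : ℕ) (v : ℕ → ℂ) (h0 : v 0 = 0) (q : ℝ) (hq : ∀ i, wk k₀ lam i * ‖v i‖ ≤ q)
    (hs : Summable (fun j : ℕ => (wk k₀ lam (j+1))^(2*n) * ‖v (j+1)‖^2)) (N : ℕ) :
    ∑ i ∈ Finset.range N, (wk k₀ lam (i+1))^(2*n) *
      -(a * (wk k₀ lam (i+2) * triX v (i+1)) + b * (wk k₀ lam (i+1) * triX v i)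
        + c * (wk k₀ lam (i-1+1) * triX v (i-1)))
    ≤ cnS a b lam n * HnS k₀ lam n v * q := by
  have hl : 0 < lam := by linarith
  have hkp := fun j => wk_pos hk₀ hlam j
  have hq0 : 0 ≤ q := le_trans (by have := hkp 0; positivity) (hq 0)
  set g : ℕ → ℝ := fun j => (wk k₀ lam (j+1))^(2*n) * ‖v (j+1)‖^2 with hg
  have hg0 : ∀ j, 0 ≤ g j := fun j => by have := hkp (j+1); positivity
  set Z : ℕ → ℝ := fun i => (wk k₀ lam (i+1))^(2*n) * (wk k₀ lam (i+1) * |triX v i|) with hZ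
  have hZ0 : Z 0 = 0 := by simp [hZ, triX_zero v h0]
  set L : ℝ := lam ^ (1 - (n:ℤ)) * q with hL
  have hL0 : 0 ≤ L := by positivity
  have hzp : lam ^ (1 - (n:ℤ)) = lam / lam^n := by
    rw [zpow_sub₀ hl.ne', zpow_one, zpow_natCast]
  have hZle : ∀ i, Z i ≤ L * ((g i + g (i+1)) / 2) := by
    intro i
    have hx := triX_abs v i
    have k1 := hkp (i+1)
    have k0 := hkp i
    set A := (wk k₀ lam (i+1))^n * ‖v (i+1)‖ with hA
    set B := (wk k₀ lam (i+2))^n * ‖v (i+2)‖ with hB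
    have hA2 : g i = A^2 := by simp only [hg, hA]; ring
    have hB2 : g (i+1) = B^2 := by simp only [hg, hB]; ring
    have hA0 : 0 ≤ A := by positivity
    have hB0 : 0 ≤ B := by have := hkp (i+2); positivity
    calc Z i ≤ (wk k₀ lam (i+1))^(2*n) * (wk k₀ lam (i+1) * (‖v i‖ * ‖v (i+1)‖ * ‖v (i+2)‖)) := by
          simp only [hZ]; gcongr
      _ = lam ^ (1 - (n:ℤ)) * (wk k₀ lam i * ‖v i‖) * (A * B) := by
          rw [hzp, hA, hB, wk_succ k₀ lam (i+1), wk_succ k₀ lam i]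
          field_simp
          ring
      _ ≤ lam ^ (1 - (n:ℤ)) * q * ((g i + g (i+1)) / 2) := by
          have := hq i
          have h2 : A * B ≤ (g i + g (i+1)) / 2 := by rw [hA2, hB2]; nlinarith [sq_nonneg (A-B)]
          gcongr
  have hsh : ∀ p N, ∑ i ∈ Finset.range N, Z (i+p) ≤ L * HnS k₀ lam n v := by
    intro p N
    have h1 := shift_sum_le g hg0 hs p N
    have h2 := shift_sum_le g hg0 hs (p+1) N
    calc _ ≤ ∑ i ∈ Finset.range N, L * ((g (i+p) + g (i+(p+1))) / 2) :=
          Finset.sum_le_sum fun i _ => hZle (i+p)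
      _ = L * ((∑ i ∈ Finset.range N, g (i+p) + ∑ i ∈ Finset.range N, g (i+(p+1))) / 2) := by
          rw [← Finset.mul_sum, ← Finset.sum_div, Finset.sum_add_distrib]
      _ ≤ L * HnS k₀ lam n v := by
          refine mul_le_mul_of_nonneg_left ?_ hL0
          change _ ≤ ∑' i, g i
          linarith
  have hsm : ∑ i ∈ Finset.range N, Z (i-1) ≤ L * HnS k₀ lam n v := by
    rcases N with _ | N
    · simpa using hsh 0 0
    · rw [Finset.sum_range_succ']
      simpa [hZ0] using hsh 0 N
  have hc : |c| = |a+b| := by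
    have : c = -(a+b) := by linarith
    rw [this, abs_neg]
  have hterm : ∀ i, (wk k₀ lam (i+1))^(2*n) *
      -(a * (wk k₀ lam (i+2) * triX v (i+1)) + b * (wk k₀ lam (i+1) * triX v i)
        + c * (wk k₀ lam (i-1+1) * triX v (i-1)))
      ≤ |a| * lam ^ (-(2*(n:ℤ))) * Z (i+1) + |b| * Z i + |a+b| * lam ^ (2*(n:ℤ)) * Z (i-1) := by
    intro i
    have e2 : lam ^ (2*(n:ℤ)) = lam^(2*n) := by
      rw [← zpow_natCast]; push_cast; rfl
    have e1 : lam ^ (-(2*(n:ℤ))) = (lam^(2*n))⁻¹ := by rw [zpow_neg, e2]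
    have t1 : lam ^ (-(2*(n:ℤ))) * Z (i+1) =
        (wk k₀ lam (i+1))^(2*n) * (wk k₀ lam (i+2) * |triX v (i+1)|) := by
      simp only [hZ]
      rw [e1, wk_succ k₀ lam (i+1), mul_pow]
      field_simp
    have t3 : lam ^ (2*(n:ℤ)) * Z (i-1) =
        (wk k₀ lam (i+1))^(2*n) * (wk k₀ lam (i-1+1) * |triX v (i-1)|) := by
      rcases i with _ | i
      · simp [hZ0, triX_zero v h0]
      · simp only [hZ, Nat.add_sub_cancel]
        rw [e2, wk_succ k₀ lam (i+1), mul_pow]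
        ring
    have hW : 0 ≤ (wk k₀ lam (i+1))^(2*n) := by have := hkp (i+1); positivity
    rw [mul_assoc |a|, t1, mul_assoc |a+b|, t3, ← hc]
    have p1 : -(a * (wk k₀ lam (i+2) * triX v (i+1))) ≤ |a| * (wk k₀ lam (i+2) * |triX v (i+1)|) := by
      refine (neg_le_abs _).trans (le_of_eq ?_)
      rw [abs_mul, abs_mul, abs_of_pos (hkp _)]
    have p2 : -(b * (wk k₀ lam (i+1) * triX v i)) ≤ |b| * (wk k₀ lam (i+1) * |triX v i|) := by
      refine (neg_le_abs _).trans (le_of_eq ?_)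
      rw [abs_mul, abs_mul, abs_of_pos (hkp _)]
    have p3 : -(c * (wk k₀ lam (i-1+1) * triX v (i-1))) ≤ |c| * (wk k₀ lam (i-1+1) * |triX v (i-1)|) := by
      refine (neg_le_abs _).trans (le_of_eq ?_)
      rw [abs_mul, abs_mul, abs_of_pos (hkp _)]
    have := mul_le_mul_of_nonneg_left (add_le_add (add_le_add p1 p2) p3) hW
    simp only [hZ]
    linarith
  refine (Finset.sum_le_sum fun i _ => hterm i).trans ?_
  rw [Finset.sum_add_distrib, Finset.sum_add_distrib, ← Finset.mul_sum, ← Finset.mul_sum,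
    ← Finset.mul_sum]
  have q1 : 0 ≤ |a| * lam ^ (-(2*(n:ℤ))) := by positivity
  have q3 : 0 ≤ |a+b| * lam ^ (2*(n:ℤ)) := by positivity
  have r1 := mul_le_mul_of_nonneg_left (hsh 1 N) q1
  have r2 := mul_le_mul_of_nonneg_left (hsh 0 N) (abs_nonneg b)
  have r3 := mul_le_mul_of_nonneg_left hsm q3
  simp only [add_zero] at r2
  refine (add_le_add (add_le_add r1 r2) r3).trans (le_of_eq ?_)
  simp only [cnS, hL]
  ring

theorem nl_zero (a b c ν k₀ lam : ℝ) (hν : 0 < ν) (hk₀ : 0 < k₀) (hlam : 1 < lam)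
    (habc : a + b + c = 0) (v : ℕ → ℂ) (h0 : v 0 = 0) (ε : ℝ)
    (K : ℕ) (hK : ∀ j ≥ K, ‖v j‖^2 ≤ ε) :
    ∑ i ∈ Finset.range (K+1),
      -(a * (wk k₀ lam (i+2) * triX v (i+1)) + b * (wk k₀ lam (i+1) * triX v i)
        + c * (wk k₀ lam (i-1+1) * triX v (i-1)))
      - ν * ((wk k₀ lam (K+1))^2 * ‖v (K+1)‖^2)
    ≤ ((|a| * lam + |c|) * ε)^2 / (4*ν) := by
  have hl : 0 < lam := by linarith
  have hkp := fun j => wk_pos hk₀ hlam j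
  have := tele a b c habc (fun i => wk k₀ lam (i+1) * triX v i) (by simp [triX_zero v h0]) K
  simp only [add_assoc, Nat.reduceAdd] at this ⊢
  rw [this]
  have hpr : ∀ i ≥ K, ∀ j ≥ K, ‖v i‖ * ‖v j‖ ≤ ε := fun i hi j hj => by
    nlinarith [hK i hi, hK j hj, sq_nonneg (‖v i‖ - ‖v j‖)]
  have k1 := hkp (K+1)
  set x := wk k₀ lam (K+1) * ‖v (K+1)‖ with hx
  have hx0 : 0 ≤ x := by positivity
  have p1 : -(a * (wk k₀ lam (K+2) * triX v (K+1))) ≤ |a| * lam * x * ε := by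
    refine (neg_le_abs _).trans ?_
    rw [abs_mul, abs_mul, abs_of_pos (hkp _), wk_succ k₀ lam (K+1)]
    calc _ ≤ |a| * (lam * wk k₀ lam (K+1) * (‖v (K+1)‖ * ‖v (K+2)‖ * ‖v (K+3)‖)) := by
            have := triX_abs v (K+1)
            gcongr
      _ = |a| * lam * x * (‖v (K+2)‖ * ‖v (K+3)‖) := by rw [hx]; ring
      _ ≤ _ := by
        have := hpr (K+2) (by omega) (K+3) (by omega)
        gcongr
  have p2 : c * (wk k₀ lam (K+1) * triX v K) ≤ |c| * x * ε := by
    refine (le_abs_self _).trans ?_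
    rw [abs_mul, abs_mul, abs_of_pos (hkp _)]
    calc _ ≤ |c| * (wk k₀ lam (K+1) * (‖v K‖ * ‖v (K+1)‖ * ‖v (K+2)‖)) := by
            have := triX_abs v K
            gcongr
      _ = |c| * x * (‖v K‖ * ‖v (K+2)‖) := by rw [hx]; ring
      _ ≤ _ := by
        have := hpr K (by omega) (K+2) (by omega)
        gcongr
  have e : ν * ((wk k₀ lam (K+1))^2 * ‖v (K+1)‖^2) = ν * x^2 := by rw [hx]; ring
  rw [e, le_div_iff₀ (by positivity)]
  have : -(a * (wk k₀ lam (K+2) * triX v (K+1)) - c * (wk k₀ lam (K+1) * triX v K)) - ν * x^2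
      ≤ (|a| * lam + |c|) * ε * x - ν * x^2 := by linarith
  have := mul_le_mul_of_nonneg_right this (show 0 ≤ 4*ν by positivity)
  nlinarith [sq_nonneg ((|a| * lam + |c|) * ε - 2 * ν * x)]

/-- the first ladder inequality
`(1/2) dH_n/dt ≤ -ν H_{n+1} + c_n H_n sup_j(k_j|u_j|) + H_n^{1/2} Φ_n^{1/2}`. -/
theorem sabra_ladder_grad (a b c ν k₀ lam : ℝ)
    (hν : 0 < ν) (hk₀ : 0 < k₀) (hlam : 1 < lam) (habc : a + b + c = 0)
    (n : ℕ) (f : ℕ → ℂ)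
    (hΦ : Summable (fun j : ℕ => (wk k₀ lam (j+1))^(2*n) * ‖f (j+1)‖^2))
    (u : ℕ → ℝ → ℂ)
    (hsol : IsSabraSolution a b c ν k₀ lam f u Set.univ)
    (t : ℝ) (D : ℝ)
    (hD : HasDerivAt (fun τ => HnS k₀ lam n (fun j => u j τ)) D t) :
    (1/2) * D ≤ -(ν * HnS k₀ lam (n+1) (fun j => u j t))
      + cnS a b lam n * HnS k₀ lam n (fun j => u j t)
          * (⨆ j : ℕ, wk k₀ lam (j+1) * ‖u (j+1) t‖)
      + Real.sqrt (HnS k₀ lam n (fun j => u j t)) * Real.sqrt (PhinS k₀ lam n f) := by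
  obtain ⟨hu0, hu⟩ := hsol
  have hkp := fun j => wk_pos hk₀ hlam j
  have hl : 0 < lam := by linarith
  have hterm0 : ∀ (m j : ℕ) (s : ℝ), 0 ≤ (wk k₀ lam (j+1))^(2*m) * ‖u (j+1) s‖^2 := fun m j s => by
    have := hkp (j+1); positivity
  have hH0 : ∀ (m : ℕ) s, 0 ≤ HnS k₀ lam m (fun j => u j s) := fun m s =>
    tsum_nonneg fun j => hterm0 m j s
  have hsig : 0 ≤ ⨆ j : ℕ, wk k₀ lam (j+1) * ‖u (j+1) t‖ :=
    Real.iSup_nonneg fun j => mul_nonneg (hkp _).le (norm_nonneg _)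
  have hcn : 0 ≤ cnS a b lam n := by unfold cnS; positivity
  have hkmono : ∀ j, k₀ ≤ wk k₀ lam j := fun j => by
    unfold wk
    exact le_mul_of_one_le_right hk₀.le (one_le_pow₀ hlam.le)
  rcases (hH0 n t).eq_or_lt with hz | hpos
  · -- degenerate case
    have hmin : IsLocalMin (fun τ => HnS k₀ lam n (fun j => u j τ)) t := by
      refine Filter.Eventually.of_forall fun s => ?_
      change HnS k₀ lam n (fun j => u j t) ≤ HnS k₀ lam n (fun j => u j s)
      rw [← hz]; exact hH0 n s
    have hD0 := hmin.hasDerivAt_eq_zero hD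
    have hH1 : HnS k₀ lam (n+1) (fun j => u j t) = 0 := by
      by_cases hs : Summable (fun j : ℕ => (wk k₀ lam (j+1))^(2*n) * ‖u (j+1) t‖^2)
      · have h1 := (hasSum_zero_iff_of_nonneg (fun j => hterm0 n j t)).1
          (by have := hs.hasSum; unfold HnS at hz; rwa [← hz] at this)
        unfold HnS
        have : (fun j : ℕ => (wk k₀ lam (j+1))^(2*(n+1)) * ‖u (j+1) t‖^2) = fun _ => 0 := by
          funext j
          have h2 := congrFun h1 j
          simp only [Pi.zero_apply] at h2
          have : (wk k₀ lam (j+1))^(2*(n+1)) * ‖u (j+1) t‖^2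
            = (wk k₀ lam (j+1))^2 * ((wk k₀ lam (j+1))^(2*n) * ‖u (j+1) t‖^2) := by ring
          rw [this, h2, mul_zero]
        rw [this, tsum_zero]
      · unfold HnS
        refine tsum_eq_zero_of_not_summable fun hs' => hs ?_
        refine Summable.of_nonneg_of_le (fun j => hterm0 n j t) (fun j => ?_)
          (hs'.mul_left ((k₀^2)⁻¹))
        rw [le_inv_mul_iff₀ (by positivity)]
        have : (wk k₀ lam (j+1))^(2*(n+1)) * ‖u (j+1) t‖^2
            = (wk k₀ lam (j+1))^2 * ((wk k₀ lam (j+1))^(2*n) * ‖u (j+1) t‖^2) := by ring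
        rw [this]
        have h3 := hkmono (j+1)
        have h4 := hterm0 n j t
        gcongr
    rw [hD0, hH1, ← hz]
    simp
  set g : ℕ → ℝ → ℝ := fun j s => (wk k₀ lam (j+1))^(2*n) * ‖u (j+1) s‖^2 with hg
  set g' : ℕ → ℝ → ℝ := fun j s => 2 * ((wk k₀ lam (j+1))^(2*n) *
    ((starRingEnd ℂ) (u (j+1) s) * sabraRHS a b c ν k₀ lam f (fun i => u i s) (j+1)).re) with hg'
  have hgd : ∀ j s, HasDerivAt (g j) (g' j s) s := fun j s =>
    hasDeriv_normsq _ _ _ _ (hu (j+1) (by omega) s trivial)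
  have hD' : HasDerivAt (fun s => ∑' j, g j s) D t := hD
  have hHc : ContinuousAt (fun s => HnS k₀ lam n (fun j => u j s)) t := hD.continuousAt
  have hsum : ∀ᶠ s in 𝓝 t, Summable (fun j => g j s) := by
    filter_upwards [hHc.eventually (lt_mem_nhds hpos)] with s hs
    by_contra hns
    have : HnS k₀ lam n (fun j => u j s) = 0 := tsum_eq_zero_of_not_summable hns
    linarith
  have huc : ∀ j, ContinuousAt (u j) t := by
    intro j
    rcases j with _ | j
    · have : u 0 = fun _ => 0 := funext hu0
      rw [this]; exact continuousAt_const
    · exact (hu (j+1) (by omega) t trivial).continuousAt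
  have htail := core_tail g t (fun j s => hterm0 n j s) (fun j => (hgd j t).continuousAt) hsum
    hD'.continuousAt
  set V : ℕ → ℝ → ℝ := fun M s => ∑ j ∈ Finset.range M,
    (wk k₀ lam (j+1))^(2*(n+1)) * ‖u (j+1) s‖^2 with hV
  have hVc : ∀ M, ContinuousAt (V M) t := fun M =>
    tendsto_finsetSum _ fun j _ => ((huc (j+1)).norm.pow 2).const_mul _
  have hVm : ∀ s, Monotone fun M => V M s := fun s =>
    monotone_nat_of_le_succ fun M => by
      simp only [hV]; rw [Finset.sum_range_succ]; linarith [hterm0 (n+1) M s]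
  set NL : ℕ → ℝ → ℝ := fun N s => ∑ i ∈ Finset.range N, (wk k₀ lam (i+1))^(2*n) *
      -(a * (wk k₀ lam (i+2) * triX (fun i => u i s) (i+1))
        + b * (wk k₀ lam (i+1) * triX (fun i => u i s) i)
        + c * (wk k₀ lam (i-1+1) * triX (fun i => u i s) (i-1))) with hNL
  have hS : ∀ s, Summable (fun j => g j s) → ∀ N, ∑ j ∈ Finset.range N, g' j s ≤
      2 * (NL N s - ν * V N s + Real.sqrt (HnS k₀ lam n (fun j => u j s))
        * Real.sqrt (PhinS k₀ lam n f)) := by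
    intro s hs N
    have hF := forcing_le (fun j => (wk k₀ lam (j+1))^(2*n))
      (fun j => by have := hkp (j+1); positivity) (fun j => u (j+1) s) (fun j => f (j+1)) hs hΦ N
    have e : ∑ j ∈ Finset.range N, g' j s = 2 * (NL N s - ν * V N s +
        ∑ j ∈ Finset.range N, (wk k₀ lam (j+1))^(2*n) *
          ((starRingEnd ℂ) (u (j+1) s) * f (j+1)).re) := by
      simp only [hg', hNL, hV]
      rw [Finset.mul_sum (f := fun j => (wk k₀ lam (j+1))^(2*(n+1)) * ‖u (j+1) s‖^2),
        ← Finset.sum_sub_distrib, ← Finset.sum_add_distrib, ← Finset.mul_sum]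
      congr 1
      refine Finset.sum_congr rfl fun j _ => ?_
      rw [rhs_re a b c ν k₀ lam f (fun i => u i s) (hu0 s) j]
      ring
    rw [e]
    unfold HnS PhinS
    linarith
  have hsqc : ContinuousAt (fun s => Real.sqrt (HnS k₀ lam n (fun j => u j s))
        * Real.sqrt (PhinS k₀ lam n f)) t := (hHc.sqrt).mul_const _
  set σ := ⨆ j : ℕ, wk k₀ lam (j+1) * ‖u (j+1) t‖ with hσ
  have hmain : ∀ M, D ≤ 2 * (-(ν * V M t) + cnS a b lam n * HnS k₀ lam n (fun j => u j t) * σ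
      + Real.sqrt (HnS k₀ lam n (fun j => u j t)) * Real.sqrt (PhinS k₀ lam n f)) := by
    intro M
    rcases Nat.eq_zero_or_pos n with hn | hn
    · subst hn
      have key : D ≤ 2 * (-(ν * V M t) + ((|a| * lam + |c|) * 0)^2 / (4*ν)
          + Real.sqrt (HnS k₀ lam 0 (fun j => u j t)) * Real.sqrt (PhinS k₀ lam 0 f)) := by
        refine lim0 D (fun ε => 2 * (-(ν * V M t) + ((|a| * lam + |c|) * ε)^2 / (4*ν)
          + Real.sqrt (HnS k₀ lam 0 (fun j => u j t)) * Real.sqrt (PhinS k₀ lam 0 f)))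
          (by fun_prop) fun ε hε => ?_
        obtain ⟨N0, hN0⟩ := htail ε hε
        refine core_deriv g g' t D (fun s => 2 * (-(ν * V M s) + ((|a| * lam + |c|) * ε)^2 / (4*ν)
          + Real.sqrt (HnS k₀ lam 0 (fun j => u j s)) * Real.sqrt (PhinS k₀ lam 0 f)))
          hgd hsum hD' ?_ ⟨N0 + M + 2, ?_⟩
        · exact ((((hVc M).const_mul ν).neg.add_const _).add hsqc).const_mul 2
        · filter_upwards [hsum, hN0] with s hs ht N hN
          obtain ⟨K, rfl⟩ : ∃ K, N = K + 1 := ⟨N - 1, by omega⟩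
          refine (hS s hs _).trans ?_
          have h1 := nl_zero a b c ν k₀ lam hν hk₀ hlam habc (fun i => u i s) (hu0 s) ε K (by
            intro j hj
            obtain ⟨i, rfl⟩ : ∃ i, j = i + 1 := ⟨j - 1, by omega⟩
            have := ht i (by omega)
            simpa [hg] using this)
          have h2 : V (K+1) s = V K s + (wk k₀ lam (K+1))^2 * ‖u (K+1) s‖^2 := by
            simp only [hV]; rw [Finset.sum_range_succ]
          have h3 : V M s ≤ V K s := hVm s (by omega)
          have h4 := mul_le_mul_of_nonneg_left h3 hν.le
          have h5 : NL (K+1) s = ∑ i ∈ Finset.range (K+1),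
            -(a * (wk k₀ lam (i+2) * triX (fun i => u i s) (i+1))
            + b * (wk k₀ lam (i+1) * triX (fun i => u i s) i)
            + c * (wk k₀ lam (i-1+1) * triX (fun i => u i s) (i-1))) := by
            simp only [hNL, mul_zero, pow_zero, one_mul]
          rw [h2, h5]
          linarith
      have h6 : 0 ≤ cnS a b lam 0 * HnS k₀ lam 0 (fun j => u j t) * σ := by
        have := hH0 0 t; positivity
      simp only [mul_zero, zero_pow two_ne_zero, zero_div, add_zero] at key
      linarith
    · have hkn : ∀ j s, (wk k₀ lam (j+1) * ‖u (j+1) s‖)^2 ≤ (k₀^(2*(n-1)))⁻¹ * g j s := by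
        intro j s
        rw [le_inv_mul_iff₀ (by positivity)]
        obtain ⟨m, rfl⟩ : ∃ m, n = m + 1 := ⟨n - 1, by omega⟩
        simp only [hg, Nat.add_sub_cancel]
        have : (wk k₀ lam (j+1))^(2*(m+1)) * ‖u (j+1) s‖^2 =
          (wk k₀ lam (j+1))^(2*m) * (wk k₀ lam (j+1) * ‖u (j+1) s‖)^2 := by ring
        rw [this]
        have := hkmono (j+1)
        gcongr
      have hbdd : BddAbove (Set.range fun j : ℕ => wk k₀ lam (j+1) * ‖u (j+1) t‖) := by
        have hst := hsum.self_of_nhds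
        refine ⟨Real.sqrt ((k₀^(2*(n-1)))⁻¹ * ∑' j, g j t), ?_⟩
        rintro _ ⟨j, rfl⟩
        refine Real.le_sqrt_of_sq_le ((hkn j t).trans ?_)
        have := hst.le_tsum j (fun i _ => hterm0 n i t)
        gcongr
      have key : D ≤ 2 * (-(ν * V M t) + cnS a b lam n * HnS k₀ lam n (fun j => u j t) * (σ + 0)
          + Real.sqrt (HnS k₀ lam n (fun j => u j t)) * Real.sqrt (PhinS k₀ lam n f)) := by
        refine lim0 D (fun ε => 2 * (-(ν * V M t)
          + cnS a b lam n * HnS k₀ lam n (fun j => u j t) * (σ + ε)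
          + Real.sqrt (HnS k₀ lam n (fun j => u j t)) * Real.sqrt (PhinS k₀ lam n f)))
          (by fun_prop) fun ε hε => ?_
        obtain ⟨N0, hN0⟩ := htail (k₀^(2*(n-1)) * ε^2) (by positivity)
        refine core_deriv g g' t D (fun s => 2 * (-(ν * V M s)
          + cnS a b lam n * HnS k₀ lam n (fun j => u j s) * (σ + ε)
          + Real.sqrt (HnS k₀ lam n (fun j => u j s)) * Real.sqrt (PhinS k₀ lam n f)))
          hgd hsum hD' ?_ ⟨M, ?_⟩
        · exact ((((hVc M).const_mul ν).neg.add ((hHc.const_mul _).mul_const _)).add hsqc).const_mul 2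
        · have hfin : ∀ᶠ s in 𝓝 t, ∀ j ∈ Finset.range N0,
              wk k₀ lam (j+1) * ‖u (j+1) s‖ < σ + ε := by
            rw [Filter.eventually_all_finset]
            intro j _
            have hc : ContinuousAt (fun s => wk k₀ lam (j+1) * ‖u (j+1) s‖) t :=
              (huc (j+1)).norm.const_mul _
            refine hc.eventually (gt_mem_nhds ?_)
            have := le_ciSup hbdd j
            linarith
          filter_upwards [hsum, hN0, hfin] with s hs ht hf N hN
          refine (hS s hs _).trans ?_
          have hq : ∀ i, wk k₀ lam i * ‖u i s‖ ≤ σ + ε := by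
            intro i
            rcases i with _ | j
            · rw [hu0 s]; simp; linarith
            · by_cases hj : j < N0
              · exact (hf j (Finset.mem_range.2 hj)).le
              · have h1 := ht j (by omega)
                have h2 : (wk k₀ lam (j+1) * ‖u (j+1) s‖)^2 ≤ ε^2 := by
                  refine (hkn j s).trans ?_
                  rw [inv_mul_le_iff₀ (by positivity)]
                  exact h1
                have := abs_le_of_sq_le_sq' h2 hε.le
                linarith [this.2]
          have h1 := nl_bound a b c k₀ lam hk₀ hlam habc n (fun i => u i s) (hu0 s) (σ + ε) hq hs N
          have h4 := mul_le_mul_of_nonneg_left (hVm s hN) hν.le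
          simp only at h4
          simp only [hNL]
          linarith
      simpa using key
  have hfinal : HnS k₀ lam (n+1) (fun j => u j t) ≤
      (cnS a b lam n * HnS k₀ lam n (fun j => u j t) * σ
      + Real.sqrt (HnS k₀ lam n (fun j => u j t)) * Real.sqrt (PhinS k₀ lam n f) - D / 2) / ν := by
    refine Real.tsum_le_of_sum_range_le (fun j => hterm0 (n+1) j t) fun M => ?_
    have := hmain M
    rw [le_div_iff₀ hν]
    change V M t * ν ≤ _
    linarith
  rw [le_div_iff₀ hν] at hfinal
  linarith
end
end

section
/- Let (u_j)_{j≥1} be a complex sequence, k_j = k_0 λ^j with k_0 > 0 and λ > 1, and n ≥ 0 an integer. Then for any real a, | a Σ_{j≥1} k_j^{2n} k_{j+1} u*_j u*_{j+1} u_{j+2} | ≤ |a| λ^{−3n+1} H_n sup_j (k_j |u_j|), where H_n = Σ_j k_j^{2n} |u_j|² (the sum being interpreted whenever H_n and sup_j k_j|u_j| are finite). -/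
open Filter MeasureTheory
open scoped BigOperators Topology

noncomputable section

/-- the estimate of the leading nonlinear term
`|a Σ_j k_j^{2n} k_{j+1} u*_j u*_{j+1} u_{j+2}| ≤ |a| λ^{-3n+1} H_n sup_j(k_j|u_j|)`. -/
theorem sabra_nonlinear_term_estimate (k₀ lam : ℝ) (hk₀ : 0 < k₀) (hlam : 1 < lam)
    (n : ℕ) (u : ℕ → ℂ) (a : ℝ)
    (hH : Summable (fun j : ℕ => (wk k₀ lam (j+1))^(2*n) * ‖u (j+1)‖^2))
    (hsup : BddAbove (Set.range fun j : ℕ => wk k₀ lam (j+1) * ‖u (j+1)‖)) :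
    ‖(a : ℂ) * ∑' j : ℕ, (((wk k₀ lam (j+1))^(2*n) * wk k₀ lam (j+2) : ℝ) : ℂ)
        * (starRingEnd ℂ) (u (j+1)) * (starRingEnd ℂ) (u (j+2)) * u (j+3)‖
      ≤ |a| * lam ^ (1 - 3*(n:ℤ)) * HnS k₀ lam n u
          * (⨆ j : ℕ, wk k₀ lam (j+1) * ‖u (j+1)‖) := by
  have hl0 : 0 < lam := by linarith
  set S : ℝ := ⨆ j : ℕ, wk k₀ lam (j+1) * ‖u (j+1)‖ with hS
  have hle : ∀ j : ℕ, wk k₀ lam (j+1) * ‖u (j+1)‖ ≤ S := fun j => le_ciSup hsup j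
  have hwk : ∀ j : ℕ, 0 < wk k₀ lam j := fun j => by unfold wk; positivity
  have hS0 : 0 ≤ S := le_trans (mul_nonneg (hwk 1).le (norm_nonneg _)) (hle 0)
  set g : ℕ → ℝ := fun j => (wk k₀ lam (j+1))^(2*n) * ‖u (j+1)‖^2 with hg
  have hg0 : ∀ j, 0 ≤ g j := fun j => mul_nonneg (pow_nonneg (hwk _).le _) (by positivity)
  have hHn : HnS k₀ lam n u = ∑' j, g j := rfl
  set C : ℝ := lam ^ (1 - 3*(n:ℤ)) with hC
  have hC0 : 0 < C := by positivity
  have hCe : C * lam ^ (3*n) = lam := by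
    rw [hC, ← zpow_natCast, ← zpow_add₀ hl0.ne']
    push_cast
    simp
  have h1 : Summable (fun j => g (j+1)) := (summable_nat_add_iff 1).2 hH
  have h2 : Summable (fun j => g (j+2)) := (summable_nat_add_iff 2).2 hH
  have e1 : ∑' j, g (j+1) ≤ ∑' j, g j := by
    have := hH.sum_add_tsum_nat_add 1
    have h0 := hg0 0
    simp only [Finset.sum_range_one] at this
    linarith
  have e2 : ∑' j, g (j+2) ≤ ∑' j, g j := by
    have := hH.sum_add_tsum_nat_add 2
    have h0 := hg0 0
    have h0' := hg0 1
    simp only [Finset.sum_range_succ, Finset.sum_range_zero] at this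
    linarith
  have hb : HasSum (fun j => C * S / 2 * (g (j+1) + g (j+2)))
      (C * S / 2 * (∑' j, g (j+1) + ∑' j, g (j+2))) :=
    (h1.hasSum.add h2.hasSum).mul_left _
  have key := tsum_of_norm_bounded (f := fun j : ℕ =>
      (((wk k₀ lam (j+1))^(2*n) * wk k₀ lam (j+2) : ℝ) : ℂ)
        * (starRingEnd ℂ) (u (j+1)) * (starRingEnd ℂ) (u (j+2)) * u (j+3)) hb (by
    intro j
    rw [norm_mul, norm_mul, norm_mul, RCLike.norm_conj, RCLike.norm_conj, Complex.norm_real,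
      Real.norm_of_nonneg (mul_nonneg (pow_nonneg (hwk _).le _) (hwk _).le)]
    have id1 : (wk k₀ lam (j+1))^(2*n) * wk k₀ lam (j+2)
        = C * wk k₀ lam (j+1) * ((wk k₀ lam (j+2))^n * (wk k₀ lam (j+3))^n) := by
      have a2 : wk k₀ lam (j+2) = lam * wk k₀ lam (j+1) := by unfold wk; ring
      have a3 : wk k₀ lam (j+3) = lam^2 * wk k₀ lam (j+1) := by unfold wk; ring
      rw [a2, a3]
      calc _ = wk k₀ lam (j+1) ^ (2*n) * (lam * wk k₀ lam (j+1)) := rfl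
        _ = wk k₀ lam (j+1) ^ (2*n) * ((C * lam ^ (3*n)) * wk k₀ lam (j+1)) := by rw [hCe]
        _ = _ := by rw [mul_pow, mul_pow]; ring
    rw [id1]
    set x := (wk k₀ lam (j+2))^n * ‖u (j+2)‖ with hx
    set y := (wk k₀ lam (j+3))^n * ‖u (j+3)‖ with hy
    have hx0 : 0 ≤ x := mul_nonneg (pow_nonneg (hwk _).le _) (norm_nonneg _)
    have hy0 : 0 ≤ y := mul_nonneg (pow_nonneg (hwk _).le _) (norm_nonneg _)
    have gx : g (j+1) = x^2 := by simp only [hg, hx]; ring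
    have gy : g (j+2) = y^2 := by simp only [hg, hy]; ring
    rw [gx, gy]
    calc _ = C * (wk k₀ lam (j+1) * ‖u (j+1)‖) * (x * y) := by rw [hx, hy]; ring
      _ ≤ C * S * (x * y) := by
        have := hle j
        gcongr
      _ ≤ C * S * ((x^2 + y^2) / 2) := by
        have : x * y ≤ (x^2 + y^2) / 2 := by nlinarith [sq_nonneg (x - y)]
        gcongr
      _ = _ := by ring)
  rw [norm_mul, Complex.norm_real, Real.norm_eq_abs, hHn]
  calc _ ≤ |a| * (C * S / 2 * (∑' j, g (j+1) + ∑' j, g (j+2))) := by gcongr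
    _ ≤ |a| * (C * S / 2 * (∑' j, g j + ∑' j, g j)) := by gcongr
    _ = _ := by ring
end
end
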